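/- Let k be a field of characteristic not 2 and n ≥ 1. If A ∈ Sp(2n,k) satisfies A² = I, then the dimension over k of the eigenspace E(A,1) = ker(A - I) (the kernel of the linear map x ↦ A·x - x on k^{2n}) is even, and likewise the dimension of E(A,-1) = ker(A + I) is even. -/

import Mathlib

open Matrix

/-- The standard symplectic form matrix `J = [[0, Iₙ], [-Iₙ, 0]]`. -/
def SpJ (n : ℕ) (R : Type*) [CommRing R] : Matrix (Fin n ⊕ Fin n) (Fin n ⊕ Fin n) R :=
  Matrix.fromBlocks 0 1 (-1) 0

/-- `M` belongs to the symplectic group `Sp(2n,R)`, i.e. `Mᵀ J M = J`. -/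
def IsSymp {n : ℕ} {R : Type*} [CommRing R]
    (M : Matrix (Fin n ⊕ Fin n) (Fin n ⊕ Fin n) R) : Prop :=
  Mᵀ * SpJ n R * M = SpJ n R

/-- A finite-dimensional space over a field of characteristic not 2 carrying a separating
skew-symmetric bilinear form has even dimension. -/
theorem even_finrank_of_skew_of_separating {k V : Type*} [Field k] [AddCommGroup V] [Module k V]
    [FiniteDimensional k V] (hchar : (2 : k) ≠ 0) (B : LinearMap.BilinForm k V)
    (hskew : ∀ x y, B y x = -B x y) (hsep : ∀ x, (∀ y, B x y = 0) → x = 0) :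
    Even (Module.finrank k V) := by
  let b := Module.finBasis k V
  have hdet : (LinearMap.BilinForm.toMatrix b B).det ≠ 0 := by
    rw [← LinearMap.BilinForm.nondegenerate_iff_det_ne_zero b]
    refine ⟨hsep, fun y hy => hsep y fun x => ?_⟩
    rw [hskew, hy, neg_zero]
  have htr : (LinearMap.BilinForm.toMatrix b B)ᵀ = -LinearMap.BilinForm.toMatrix b B := by
    ext i j
    rw [Matrix.transpose_apply, Matrix.neg_apply, LinearMap.BilinForm.toMatrix_apply,
      LinearMap.BilinForm.toMatrix_apply, hskew (b i) (b j)]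
  have h := congrArg Matrix.det htr
  rw [Matrix.det_transpose, Matrix.det_neg, Fintype.card_fin] at h
  by_contra hodd
  rw [(Nat.not_even_iff_odd.mp hodd).neg_one_pow] at h
  have : (2 : k) * (LinearMap.BilinForm.toMatrix b B).det = 0 := by linear_combination h
  exact (mul_ne_zero hchar hdet) this

theorem SpJ_mul_SpJ (n : ℕ) (R : Type*) [CommRing R] : SpJ n R * SpJ n R = -1 := by
  rw [SpJ, Matrix.fromBlocks_multiply, ← Matrix.fromBlocks_one, Matrix.fromBlocks_neg]
  simp

theorem SpJ_transpose (n : ℕ) (R : Type*) [CommRing R] : (SpJ n R)ᵀ = -SpJ n R := by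
  rw [SpJ, Matrix.fromBlocks_transpose, Matrix.fromBlocks_neg]
  simp

/-- The fixed space of a symplectic involution has even dimension. -/
theorem IsSymp.even_finrank_ker_sub_one {k : Type*} [Field k] (hchar : (2 : k) ≠ 0) {n : ℕ}
    {A : Matrix (Fin n ⊕ Fin n) (Fin n ⊕ Fin n) k} (hA : IsSymp A) (h2 : A * A = 1) :
    Even (Module.finrank k (LinearMap.ker (A - 1).mulVecLin)) := by
  have hmem : ∀ x, x ∈ LinearMap.ker (A - 1).mulVecLin ↔ A *ᵥ x = x := fun x => by
    simp [sub_eq_zero]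
  let B := Matrix.toBilin' (SpJ n k)
  have hB : ∀ x y, B x y = x ⬝ᵥ SpJ n k *ᵥ y := fun x y => Matrix.toBilin'_apply' _ _ _
  have hinv : ∀ x y, B (A *ᵥ x) (A *ᵥ y) = B x y := fun x y => by
    conv_rhs => rw [hB, ← show Aᵀ * SpJ n k * A = SpJ n k from hA]
    rw [hB, ← Matrix.mulVec_mulVec, ← Matrix.mulVec_mulVec, Matrix.dotProduct_mulVec x Aᵀ,
      Matrix.vecMul_transpose]
  refine even_finrank_of_skew_of_separating hchar
    (B.restrict (LinearMap.ker (A - 1).mulVecLin)) (fun x y => ?_) (fun x hx => ?_)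
  · change B y x = -B x y
    rw [hB, hB, Matrix.dotProduct_mulVec, dotProduct_comm, ← Matrix.mulVec_transpose,
      SpJ_transpose, Matrix.neg_mulVec, dotProduct_neg]
  · have hAx := (hmem x).mp x.2
    have hzero : ∀ y, B x y = 0 := fun y => by
      have hfix : y + A *ᵥ y ∈ LinearMap.ker (A - 1).mulVecLin := by
        rw [hmem, Matrix.mulVec_add, Matrix.mulVec_mulVec, h2, Matrix.one_mulVec, add_comm]
      have h1 : B x (y + A *ᵥ y) = 0 := hx ⟨_, hfix⟩
      have h3 := hinv x y
      rw [hAx] at h3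
      rw [map_add, h3, ← two_mul] at h1
      exact (mul_eq_zero.mp h1).resolve_left hchar
    have hJ : (x : Fin n ⊕ Fin n → k) ᵥ* SpJ n k = 0 := by
      refine dotProduct_eq_zero _ fun y => ?_
      rw [← Matrix.dotProduct_mulVec, ← hB, hzero]
    have h := congrArg (· ᵥ* SpJ n k) hJ
    simp only [Matrix.vecMul_vecMul, SpJ_mul_SpJ, Matrix.vecMul_neg, Matrix.vecMul_one,
      Matrix.zero_vecMul, neg_eq_zero] at h
    exact Subtype.ext h

/-- For `A ∈ Sp(2n,k)` with `A² = I`, the eigenspaces `E(A,1) = ker(A - I)` and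
`E(A,-1) = ker(A + I)` both have even dimension. -/
theorem stmt4 {k : Type*} [Field k] (hchar : (2 : k) ≠ 0) {n : ℕ} (hn : 1 ≤ n)
    (A : Matrix (Fin n ⊕ Fin n) (Fin n ⊕ Fin n) k) (hA : IsSymp A)
    (h2 : A * A = 1) :
    Even (Module.finrank k (LinearMap.ker (A - 1).mulVecLin)) ∧
    Even (Module.finrank k (LinearMap.ker (A + 1).mulVecLin)) := by
  refine ⟨hA.even_finrank_ker_sub_one hchar h2, ?_⟩
  have hneg : IsSymp (-A) := by
    simpa [IsSymp] using hA
  have hker : LinearMap.ker (A + 1).mulVecLin = LinearMap.ker (-A - 1).mulVecLin := by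
    ext x
    rw [← neg_add' A 1]
    simp [-neg_add_rev]
  rw [hker]
  exact hneg.even_finrank_ker_sub_one hchar (by rw [neg_mul_neg, h2])
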